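/- There exists a constant C₁ > 0, independent of the grid resolution, such that for every integer N ≥ 2 (h = 1/N) and every cell-centered grid function φ with zero discrete mean h² Σ_{i,j} φ_{i+1/2,j+1/2} = 0, the discrete Sobolev interpolation inequality ‖∇_h φ‖_∞ ≤ C₁ ‖∇_h φ‖₂^{1/2} · ‖∇_h Δ_h φ‖₂^{1/2} holds, where Δ_h φ is the five-point discrete Laplacian (using the Neumann ghost extension) and ∇_h Δ_h φ its discrete gradient (again with Neumann ghost extension of Δ_h φ). -/

import Mathlib

noncomputable section
open Finset

namespace MAC

/-- Clamp an integer index into the range `[0, N-1]`; used to implement the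
single-layer mirror (ghost) extensions on the MAC grid. -/
def cl (N : ℕ) (i : ℤ) : ℤ := max 0 (min i ((N : ℤ) - 1))

/-- Discrete homogeneous Neumann (mirror) ghost extension of a cell-centered
grid function `f`, where `f i j` stands for `f_{i+1/2,j+1/2}`, `0 ≤ i,j ≤ N-1`. -/
def extC (N : ℕ) (f : ℤ → ℤ → ℝ) (i j : ℤ) : ℝ := f (cl N i) (cl N j)

/-- Free-slip ghost extension of the x-component of a MAC vector
(`f i j` stands for `uˣ_{i,j+1/2}`): mirror reflection in `j`. -/
def extX (N : ℕ) (f : ℤ → ℤ → ℝ) (i j : ℤ) : ℝ := f i (cl N j)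

/-- Free-slip ghost extension of the y-component of a MAC vector
(`f i j` stands for `uʸ_{i+1/2,j}`): mirror reflection in `i`. -/
def extY (N : ℕ) (f : ℤ → ℤ → ℝ) (i j : ℤ) : ℝ := f (cl N i) j

/-- Discrete cell-centered inner product `⟨f,g⟩_c`. -/
def ipC (N : ℕ) (h : ℝ) (f g : ℤ → ℤ → ℝ) : ℝ :=
  h ^ 2 * ∑ i ∈ range N, ∑ j ∈ range N, f i j * g i j

/-- Discrete mean `h² Σ f`. -/
def meanC (N : ℕ) (h : ℝ) (f : ℤ → ℤ → ℝ) : ℝ :=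
  h ^ 2 * ∑ i ∈ range N, ∑ j ∈ range N, f i j

/-- MAC vector inner product `⟨u,v⟩₁`, summing over all edge points. -/
def ipV (N : ℕ) (h : ℝ) (ux uy vx vy : ℤ → ℤ → ℝ) : ℝ :=
  h ^ 2 * ∑ i ∈ range (N + 1), ∑ j ∈ range N, ux i j * vx i j
    + h ^ 2 * ∑ i ∈ range N, ∑ j ∈ range (N + 1), uy i j * vy i j

/-- `‖f‖₂²` for a cell-centered function. -/
def normC2 (N : ℕ) (h : ℝ) (f : ℤ → ℤ → ℝ) : ℝ := ipC N h f f

/-- `‖u‖₂²` for a MAC vector. -/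
def normV2 (N : ℕ) (h : ℝ) (ux uy : ℤ → ℤ → ℝ) : ℝ := ipV N h ux uy ux uy

/-- x-component of the MAC gradient of a cell-centered function,
located at east-west edge points `(i, j+1/2)`, `0 ≤ i ≤ N`, `0 ≤ j ≤ N-1`. -/
def gradX (N : ℕ) (h : ℝ) (f : ℤ → ℤ → ℝ) (i j : ℤ) : ℝ :=
  (extC N f i j - extC N f (i - 1) j) / h

/-- y-component of the MAC gradient of a cell-centered function,
located at north-south edge points `(i+1/2, j)`. -/
def gradY (N : ℕ) (h : ℝ) (f : ℤ → ℤ → ℝ) (i j : ℤ) : ℝ :=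
  (extC N f i j - extC N f i (j - 1)) / h

/-- Five-point Laplacian of a cell-centered function (Neumann ghosts). -/
def lapC (N : ℕ) (h : ℝ) (f : ℤ → ℤ → ℝ) (i j : ℤ) : ℝ :=
  (extC N f (i + 1) j + extC N f (i - 1) j + extC N f i (j + 1)
      + extC N f i (j - 1) - 4 * extC N f i j) / h ^ 2

/-- MAC divergence of a vector at cell centers. -/
def divV (h : ℝ) (ux uy : ℤ → ℤ → ℝ) (i j : ℤ) : ℝ :=
  (ux (i + 1) j - ux i j) / h + (uy i (j + 1) - uy i j) / h

/-- `‖∇_h f‖₂²` for a cell-centered function (gradient components summed over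
all edge points). -/
def gnormC2 (N : ℕ) (h : ℝ) (f : ℤ → ℤ → ℝ) : ℝ :=
  normV2 N h (gradX N h f) (gradY N h f)

/-- Average of a cell-centered function to east-west edge points. -/
def avX (N : ℕ) (f : ℤ → ℤ → ℝ) (i j : ℤ) : ℝ :=
  (extC N f (i - 1) j + extC N f i j) / 2

/-- Average of a cell-centered function to north-south edge points. -/
def avY (N : ℕ) (f : ℤ → ℤ → ℝ) (i j : ℤ) : ℝ :=
  (extC N f i (j - 1) + extC N f i j) / 2

/-- MAC divergence `∇_h·(f u)` with edge-averaged `f`, at cell centers. -/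
def divFU (N : ℕ) (h : ℝ) (f ux uy : ℤ → ℤ → ℝ) (i j : ℤ) : ℝ :=
  (ux (i + 1) j * avX N f (i + 1) j - ux i j * avX N f i j) / h
    + (uy i (j + 1) * avY N f i (j + 1) - uy i j * avY N f i j) / h

/-- Componentwise MAC Laplacian of the x-component (free-slip tangential ghosts). -/
def lapVX (N : ℕ) (h : ℝ) (ux : ℤ → ℤ → ℝ) (i j : ℤ) : ℝ :=
  (ux (i + 1) j + ux (i - 1) j + extX N ux i (j + 1) + extX N ux i (j - 1)
      - 4 * ux i j) / h ^ 2

/-- Componentwise MAC Laplacian of the y-component (free-slip tangential ghosts). -/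
def lapVY (N : ℕ) (h : ℝ) (uy : ℤ → ℤ → ℝ) (i j : ℤ) : ℝ :=
  (extY N uy (i + 1) j + extY N uy (i - 1) j + uy i (j + 1) + uy i (j - 1)
      - 4 * uy i j) / h ^ 2

/-- `‖∇_h v‖₂²` for a MAC vector `v`. -/
def gnormV2 (N : ℕ) (h : ℝ) (ux uy : ℤ → ℤ → ℝ) : ℝ :=
  h ^ 2 * ∑ i ∈ range N, ∑ j ∈ range N, ((ux (i + 1) j - ux i j) / h) ^ 2
    + h ^ 2 * ∑ i ∈ range (N + 1), ∑ j ∈ range (N + 1),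
        ((extX N ux i j - extX N ux i (j - 1)) / h) ^ 2
    + h ^ 2 * ∑ i ∈ range (N + 1), ∑ j ∈ range (N + 1),
        ((extY N uy i j - extY N uy (i - 1) j) / h) ^ 2
    + h ^ 2 * ∑ i ∈ range N, ∑ j ∈ range N, ((uy i (j + 1) - uy i j) / h) ^ 2

/-- `‖v‖₄` for a MAC vector. -/
noncomputable def norm4V (N : ℕ) (h : ℝ) (ux uy : ℤ → ℤ → ℝ) : ℝ :=
  (h ^ 2 * ∑ i ∈ range (N + 1), ∑ j ∈ range N, |ux i j| ^ 4
      + h ^ 2 * ∑ i ∈ range N, ∑ j ∈ range (N + 1), |uy i j| ^ 4) ^ ((1 : ℝ) / 4)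

/-- Discrete no-penetration boundary condition. -/
def NoPen (N : ℕ) (ux uy : ℤ → ℤ → ℝ) : Prop :=
  (∀ j : ℤ, 0 ≤ j → j < N → ux 0 j = 0 ∧ ux N j = 0) ∧
    (∀ i : ℤ, 0 ≤ i → i < N → uy i 0 = 0 ∧ uy i N = 0)

/-- Discrete SAV energy `E_{1,h}`. -/
def E1h (N : ℕ) (h : ℝ) (f : ℤ → ℤ → ℝ) : ℝ :=
  h ^ 2 * ∑ i ∈ range N, ∑ j ∈ range N,
    ((1 / 4) * f i j ^ 4 - (1 / 2) * f i j ^ 2 + 5 / 4)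

end MAC

end

namespace MAC

section OneDimensional

open Finset

/-- Summation by parts for the second difference. -/
theorem sum_mul_second_diff (v w : ℤ → ℝ) (N : ℕ) :
    ∑ k ∈ range N, v k * (w (k + 1) - 2 * w k + w (k - 1))
      = v N * (w N - w (N - 1)) - v 0 * (w 0 - w (-1))
        - ∑ k ∈ range N, (v (k + 1) - v k) * (w (k + 1) - w k) := by
  induction N with
  | zero => simp
  | succ n ih =>
    rw [sum_range_succ, sum_range_succ, ih]
    push_cast
    rw [add_sub_cancel_right]
    ring

theorem abs_sub_le_sum_abs_diff (f : ℕ → ℝ) {N m k : ℕ} (hm : m ≤ N) (hk : k ≤ N) :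
    |f m - f k| ≤ ∑ i ∈ range N, |f (i + 1) - f i| := by
  wlog hmk : m ≤ k generalizing m k
  · rw [abs_sub_comm]
    exact this hk hm (le_of_not_ge hmk)
  calc |f m - f k| ≤ ∑ i ∈ Ico m k, |f (i + 1) - f i| := by
        refine (dist_le_Ico_sum_dist f hmk).trans_eq (sum_congr rfl fun i _ => ?_)
        rw [dist_comm, Real.dist_eq]
    _ ≤ ∑ i ∈ range N, |f (i + 1) - f i| := by
        refine sum_le_sum_of_subset_of_nonneg (fun i hi => ?_) fun _ _ _ => abs_nonneg _
        simp only [mem_Ico, mem_range] at hi ⊢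
        omega

/-- Cauchy–Schwarz for the variation of a sum of squares. -/
theorem sum_abs_sq_sub_sq_le {ι : Type*} (s : Finset ι) (a b : ι → ℝ) :
    (∑ i ∈ s, |a i ^ 2 - b i ^ 2|) ^ 2
      ≤ (∑ i ∈ s, (a i - b i) ^ 2) * (2 * (∑ i ∈ s, a i ^ 2 + ∑ i ∈ s, b i ^ 2)) := by
  have h1 : ∀ i, |a i ^ 2 - b i ^ 2| = |a i - b i| * |a i + b i| := fun i => by
    rw [← abs_mul]; congr 1; ring
  simp only [h1]
  refine (sum_mul_sq_le_sq_mul_sq s _ _).trans ?_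
  simp only [sq_abs]
  refine mul_le_mul_of_nonneg_left ?_ (sum_nonneg fun _ _ => sq_nonneg _)
  rw [← sum_add_distrib, mul_sum]
  exact sum_le_sum fun i _ => by nlinarith [sq_nonneg (a i - b i)]

/-- One-dimensional Agmon inequality with Dirichlet conditions. -/
theorem pow_four_le_of_dirichlet (f : ℕ → ℝ) {N m : ℕ} (h0 : f 0 = 0) (hN : f N = 0)
    (hm : m ≤ N) :
    f m ^ 4 ≤ 4 * (∑ i ∈ range N, f i ^ 2) * ∑ i ∈ range N, (f (i + 1) - f i) ^ 2 := by
  have h1 := abs_sub_le_sum_abs_diff (fun i => f i ^ 2) hm (Nat.zero_le N)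
  have h2 := sum_abs_sq_sub_sq_le (range N) (fun i => f (i + 1)) f
  have h3 : ∑ i ∈ range N, f (i + 1) ^ 2 = ∑ i ∈ range N, f i ^ 2 := by
    have := sum_range_succ' (fun i => f i ^ 2) N
    rw [sum_range_succ] at this
    simpa [h0, hN] using this.symm
  have h4 : f m ^ 2 ≤ ∑ i ∈ range N, |f (i + 1) ^ 2 - f i ^ 2| := by
    simpa [h0] using h1
  have h5 := pow_le_pow_left₀ (sq_nonneg (f m)) h4 2
  rw [h3] at h2
  nlinarith

/-- Discrete Poincaré inequality with a Dirichlet condition. -/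
theorem sum_sq_le_of_dirichlet (f : ℕ → ℝ) (N : ℕ) (h0 : f 0 = 0) :
    ∑ i ∈ range N, f i ^ 2 ≤ (N : ℝ) ^ 2 * ∑ i ∈ range N, (f (i + 1) - f i) ^ 2 := by
  have h1 : ∀ i ∈ range N, f i ^ 2 ≤ N * ∑ i ∈ range N, (f (i + 1) - f i) ^ 2 := by
    intro i hi
    have h2 := abs_sub_le_sum_abs_diff f (mem_range.1 hi).le (Nat.zero_le N)
    rw [h0, sub_zero] at h2
    have h3 := pow_le_pow_left₀ (abs_nonneg _) h2 2
    rw [sq_abs] at h3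
    refine h3.trans (sq_sum_le_card_mul_sum_sq.trans_eq ?_)
    simp
  refine (sum_le_sum h1).trans_eq ?_
  simp
  ring

/-- One-dimensional Agmon inequality with a Neumann condition, for a finite family of functions. -/
theorem sum_sq_le_of_neumann (g : ℕ → ℕ → ℝ) {N m : ℕ} (hg : ∀ i, g i N = g i (N - 1))
    (hm : m < N) :
    ∑ i ∈ range N, g i m ^ 2
      ≤ (∑ i ∈ range N, ∑ j ∈ range N, g i j ^ 2) / N
        + 3 * √((∑ i ∈ range N, ∑ j ∈ range N, g i j ^ 2)
            * ∑ i ∈ range N, ∑ j ∈ range N, (g i (j + 1) - g i j) ^ 2) := by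
  set S := ∑ i ∈ range N, ∑ j ∈ range N, g i j ^ 2 with hS
  set T := ∑ i ∈ range N, ∑ j ∈ range N, (g i (j + 1) - g i j) ^ 2 with hT
  set G : ℕ → ℝ := fun j => ∑ i ∈ range N, g i j ^ 2 with hG
  have hS0 : 0 ≤ S := sum_nonneg fun _ _ => sum_nonneg fun _ _ => sq_nonneg _
  have hT0 : 0 ≤ T := sum_nonneg fun _ _ => sum_nonneg fun _ _ => sq_nonneg _
  have hNpos : (0 : ℝ) < N := by exact_mod_cast (Nat.zero_le m).trans_lt hm
  set V := ∑ j ∈ range N, |G (j + 1) - G j| with hV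
  have hVS : V ≤ 3 * √(S * T) := by
    have h1 : V ≤ ∑ p ∈ range N ×ˢ range N, |g p.1 (p.2 + 1) ^ 2 - g p.1 p.2 ^ 2| := by
      rw [sum_product_right]
      refine sum_le_sum fun j _ => ?_
      simp only [hG, ← sum_sub_distrib]
      exact abs_sum_le_sum_abs _ _
    have h2 := sum_abs_sq_sub_sq_le (range N ×ˢ range N)
      (fun p => g p.1 (p.2 + 1)) (fun p => g p.1 p.2)
    have h3 : ∑ p ∈ range N ×ˢ range N, g p.1 (p.2 + 1) ^ 2 ≤ 2 * S := by
      rw [sum_product, hS, mul_sum]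
      refine sum_le_sum fun i _ => ?_
      have h4 := sum_range_succ' (fun j => g i j ^ 2) N
      rw [sum_range_succ] at h4
      have h5 : g i N ^ 2 ≤ ∑ j ∈ range N, g i j ^ 2 := by
        rw [hg]
        exact single_le_sum (f := fun j => g i j ^ 2) (fun _ _ => sq_nonneg _)
          (mem_range.2 (by omega))
      nlinarith [sq_nonneg (g i 0)]
    have h6 : V ^ 2 ≤ 9 * (S * T) := by
      have hV0 : 0 ≤ V := sum_nonneg fun _ _ => abs_nonneg _
      have h7 := pow_le_pow_left₀ hV0 h1 2
      have h8 : ∑ p ∈ range N ×ˢ range N, (g p.1 (p.2 + 1) - g p.1 p.2) ^ 2 = T := by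
        rw [sum_product]
      have h9 : ∑ p ∈ range N ×ˢ range N, g p.1 p.2 ^ 2 = S := by rw [sum_product]
      rw [h8, h9] at h2
      nlinarith [mul_nonneg hS0 hT0, mul_le_mul_of_nonneg_left h3 hT0]
    refine le_of_abs_le (abs_le_of_sq_le_sq ?_ (by positivity))
    rw [mul_pow, Real.sq_sqrt (mul_nonneg hS0 hT0)]
    linarith
  have hk : ∀ k ∈ range N, G m - V ≤ G k := fun k hk => by
    have := abs_sub_le_sum_abs_diff G hm.le (mem_range.1 hk).le
    linarith [le_abs_self (G m - G k)]
  have hsum := sum_le_sum hk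
  have hSG : ∑ k ∈ range N, G k = S := sum_comm
  rw [hSG, sum_const, card_range, nsmul_eq_mul, mul_comm, ← le_div_iff₀ hNpos] at hsum
  change G m ≤ _
  linarith

end OneDimensional

section TwoDimensional

open Finset

/-- The real-number bookkeeping that combines the one-dimensional estimates. -/
theorem pow_four_le_of_estimates {z U L X Y Z a b n : ℝ} (hn : 0 < n) (hU : 0 ≤ U) (hL : 0 ≤ L)
    (hX : 0 ≤ X) (hY : 0 ≤ Y) (hb : 0 ≤ b) (hz : z ^ 4 ≤ 4 * a * b)
    (ha : a ≤ U / n + 3 * √(U * Y)) (hb' : b ≤ X / n + 3 * √(X * Z))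
    (hXY : (X + Y) ^ 2 ≤ U * L) (hZ : Z ≤ L) (hP : U ≤ n ^ 2 * X) :
    z ^ 4 ≤ 64 * (U * L) := by
  obtain ⟨p, hp, rfl⟩ : ∃ p : ℝ, 0 ≤ p ∧ U = p ^ 4 :=
    ⟨√√U, Real.sqrt_nonneg _, by
      rw [show (4 : ℕ) = 2 * 2 from rfl, pow_mul, Real.sq_sqrt (Real.sqrt_nonneg _),
        Real.sq_sqrt hU]⟩
  obtain ⟨q, hq, rfl⟩ : ∃ q : ℝ, 0 ≤ q ∧ L = q ^ 4 :=
    ⟨√√L, Real.sqrt_nonneg _, by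
      rw [show (4 : ℕ) = 2 * 2 from rfl, pow_mul, Real.sq_sqrt (Real.sqrt_nonneg _),
        Real.sq_sqrt hL]⟩
  have h1 : X + Y ≤ p ^ 2 * q ^ 2 :=
    le_of_abs_le (abs_le_of_sq_le_sq (by nlinarith) (by positivity))
  have hX1 : X ≤ p ^ 2 * q ^ 2 := by linarith
  have hY1 : Y ≤ p ^ 2 * q ^ 2 := by linarith
  have h2 : p ≤ n * q := by
    by_contra! h
    have hp0 : 0 < p := (by positivity : (0 : ℝ) ≤ n * q).trans_lt h
    have h3 : (n * q) ^ 2 < p ^ 2 := pow_lt_pow_left₀ h (by positivity) (by norm_num)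
    have h4 : n ^ 2 * X ≤ n ^ 2 * (p ^ 2 * q ^ 2) := by gcongr
    have h5 : p ^ 2 * (n * q) ^ 2 < p ^ 2 * p ^ 2 := by gcongr
    nlinarith
  have hpn : p / n ≤ q := by rw [div_le_iff₀ hn]; linarith
  have hs1 : √(p ^ 4 * Y) ≤ p ^ 3 * q := by
    rw [Real.sqrt_le_left (by positivity)]
    calc p ^ 4 * Y ≤ p ^ 4 * (p ^ 2 * q ^ 2) := by gcongr
      _ = (p ^ 3 * q) ^ 2 := by ring
  have hs2 : √(X * Z) ≤ p * q ^ 3 := by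
    rw [Real.sqrt_le_left (by positivity)]
    calc X * Z ≤ X * q ^ 4 := by gcongr
      _ ≤ p ^ 2 * q ^ 2 * q ^ 4 := by gcongr
      _ = (p * q ^ 3) ^ 2 := by ring
  have ha4 : a ≤ 4 * (p ^ 3 * q) := by
    have : p ^ 4 / n ≤ p ^ 3 * q := by
      calc p ^ 4 / n = p ^ 3 * (p / n) := by ring
        _ ≤ p ^ 3 * q := by gcongr
    linarith
  have hb4 : b ≤ 4 * (p * q ^ 3) := by
    have : X / n ≤ p * q ^ 3 := by
      calc X / n ≤ p ^ 2 * q ^ 2 / n := by gcongr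
        _ = p * q ^ 2 * (p / n) := by ring
        _ ≤ p * q ^ 2 * q := by gcongr
        _ = p * q ^ 3 := by ring
    linarith
  calc z ^ 4 ≤ 4 * a * b := hz
    _ ≤ 4 * (4 * (p ^ 3 * q)) * (4 * (p * q ^ 3)) := by gcongr
    _ = 64 * (p ^ 4 * q ^ 4) := by ring

variable {N : ℕ} {u w : ℤ → ℤ → ℝ}

/-- Energy identity `⟨u, Δu⟩ = -‖∇u‖²` with Dirichlet conditions in the first variable and
Neumann conditions in the second. -/
theorem sum_mul_lap_eq (h0 : ∀ j, u 0 j = 0) (hN : ∀ j, u N j = 0)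
    (hb : ∀ i, u i (-1) = u i 0) (ht : ∀ i, u i N = u i (N - 1))
    (hw : ∀ i j : ℕ, 0 < i → i < N → j < N →
      w i j = (u (i + 1) j - 2 * u i j + u (i - 1) j)
        + (u i (j + 1) - 2 * u i j + u i (j - 1))) :
    ∑ i ∈ range N, ∑ j ∈ range N, u i j * w i j
      = -(∑ i ∈ range N, ∑ j ∈ range N, (u (i + 1) j - u i j) ^ 2
        + ∑ i ∈ range N, ∑ j ∈ range N, (u i (j + 1) - u i j) ^ 2) := by
  have hsplit : ∀ i ∈ range N, ∀ j ∈ range N, u i j * w i j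
      = u i j * (u (i + 1) j - 2 * u i j + u (i - 1) j)
        + u i j * (u i (j + 1) - 2 * u i j + u i (j - 1)) := by
    intro i hi j hj
    rcases Nat.eq_zero_or_pos i with rfl | hi0
    · simp [h0]
    · rw [hw i j hi0 (mem_range.1 hi) (mem_range.1 hj)]
      ring
  rw [sum_congr rfl fun i hi => sum_congr rfl (hsplit i hi)]
  simp only [sum_add_distrib]
  rw [neg_add]
  congr 1
  · rw [sum_comm, sum_comm (f := fun i j : ℕ => (u (i + 1) j - u i j) ^ 2), ← sum_neg_distrib]
    refine sum_congr rfl fun j _ => ?_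
    rw [sum_mul_second_diff (fun i => u i j) (fun i => u i j)]
    simp [h0, hN, sq]
  · rw [← sum_neg_distrib]
    refine sum_congr rfl fun i _ => ?_
    rw [sum_mul_second_diff (fun j => u i j) (fun j => u i j)]
    simp [hb, ht, sq]

/-- The mixed second difference is controlled by the Laplacian. -/
theorem sum_mixed_diff_sq_le (h0 : ∀ j, u 0 j = 0) (hN : ∀ j, u N j = 0)
    (hb : ∀ i, u i (-1) = u i 0) (ht : ∀ i, u i N = u i (N - 1))
    (hw : ∀ i j : ℕ, 0 < i → i < N → j < N →
      w i j = (u (i + 1) j - 2 * u i j + u (i - 1) j)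
        + (u i (j + 1) - 2 * u i j + u i (j - 1))) :
    ∑ i ∈ range N, ∑ j ∈ range N,
        ((u (i + 1) (j + 1) - u i (j + 1)) - (u (i + 1) j - u i j)) ^ 2
      ≤ ∑ i ∈ range N, ∑ j ∈ range N, w i j ^ 2 := by
  have hpos : 0 ≤ ∑ i ∈ range N, ∑ j ∈ range N,
      ((u (i + 1) (j + 1) - u i (j + 1)) - (u (i + 1) j - u i j)) ^ 2 :=
    sum_nonneg fun _ _ => sum_nonneg fun _ _ => sq_nonneg _
  have key : ∑ i ∈ range N, ∑ j ∈ range N,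
      (u i (j + 1) - 2 * u i j + u i (j - 1)) * (u (i + 1) j - 2 * u i j + u (i - 1) j)
      = ∑ i ∈ range N, ∑ j ∈ range N,
        ((u (i + 1) (j + 1) - u i (j + 1)) - (u (i + 1) j - u i j)) ^ 2 := by
    calc _ = ∑ j ∈ range N, ∑ i ∈ range N, -((u (i + 1) j - u i j) *
          ((u (i + 1) (j + 1) - u i (j + 1)) - 2 * (u (i + 1) j - u i j)
            + (u (i + 1) (j - 1) - u i (j - 1)))) := by
          rw [sum_comm]
          refine sum_congr rfl fun j _ => ?_
          rw [sum_mul_second_diff (fun i => u i (j + 1) - 2 * u i j + u i (j - 1))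
            (fun i => u i j)]
          simp only [h0, hN, sum_neg_distrib]
          simp only [mul_zero, sub_zero, add_zero, zero_mul, zero_sub]
          congr 1
          exact sum_congr rfl fun i _ => by ring
      _ = _ := by
          rw [sum_comm]
          refine sum_congr rfl fun i _ => ?_
          rw [sum_neg_distrib, sum_mul_second_diff (fun j => u (i + 1) j - u i j)
            (fun j => u (i + 1) j - u i j)]
          simp [hb, ht, sq]
  have hle : ∑ i ∈ range N, ∑ j ∈ range N,
      (u i (j + 1) - 2 * u i j + u i (j - 1)) * (u (i + 1) j - 2 * u i j + u (i - 1) j)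
      ≤ (∑ i ∈ range N, ∑ j ∈ range N, w i j ^ 2) / 4 := by
    simp only [sum_div]
    refine sum_le_sum fun i hi => sum_le_sum fun j hj => ?_
    rcases Nat.eq_zero_or_pos i with rfl | hi0
    · simp only [Nat.cast_zero, h0]
      nlinarith [sq_nonneg (w 0 j)]
    · rw [hw i j hi0 (mem_range.1 hi) (mem_range.1 hj)]
      nlinarith [sq_nonneg ((u (i + 1) j - 2 * u i j + u (i - 1) j)
        - (u i (j + 1) - 2 * u i j + u i (j - 1)))]
  linarith

/-- Two-dimensional discrete Agmon inequality with Dirichlet conditions in the first variable and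
Neumann conditions in the second. -/
theorem pow_four_le_sum_mul_sum_lap (h0 : ∀ j, u 0 j = 0) (hN : ∀ j, u N j = 0)
    (hb : ∀ i, u i (-1) = u i 0) (ht : ∀ i, u i N = u i (N - 1))
    (hw : ∀ i j : ℕ, 0 < i → i < N → j < N →
      w i j = (u (i + 1) j - 2 * u i j + u (i - 1) j)
        + (u i (j + 1) - 2 * u i j + u i (j - 1)))
    {m k : ℕ} (hm : m ≤ N) (hk : k < N) :
    u m k ^ 4 ≤ 64 * ((∑ i ∈ range N, ∑ j ∈ range N, u i j ^ 2)
      * ∑ i ∈ range N, ∑ j ∈ range N, w i j ^ 2) := by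
  have hpred : ((N - 1 : ℕ) : ℤ) = N - 1 := by omega
  have hCS := sum_mul_sq_le_sq_mul_sq (range N ×ˢ range N)
    (fun p => u p.1 p.2) (fun p => w p.1 p.2)
  simp only [sum_product] at hCS
  rw [sum_mul_lap_eq h0 hN hb ht hw, neg_sq] at hCS
  have hpoinc : ∑ i ∈ range N, ∑ j ∈ range N, u i j ^ 2
      ≤ (N : ℝ) ^ 2 * ∑ i ∈ range N, ∑ j ∈ range N, (u (i + 1) j - u i j) ^ 2 := by
    rw [sum_comm, sum_comm (f := fun i j : ℕ => (u (i + 1) j - u i j) ^ 2), mul_sum]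
    exact sum_le_sum fun j _ => by
      simpa using sum_sq_le_of_dirichlet (fun i => u i j) N (by simpa using h0 j)
  have hag := pow_four_le_of_dirichlet (fun i => u i k) (by simpa using h0 k) (hN k) hm
  have hU := sum_sq_le_of_neumann (fun i j => u i j) (fun i => by rw [hpred]; exact ht i) hk
  have hX := sum_sq_le_of_neumann (fun i j => u (i + 1) j - u i j)
    (fun i => by rw [hpred, ht, ht]) hk
  push_cast at hag hU hX
  refine pow_four_le_of_estimates (by exact_mod_cast (Nat.zero_le k).trans_lt hk)
    ?_ ?_ ?_ ?_ ?_ hag hU hX hCS (sum_mixed_diff_sq_le h0 hN hb ht hw) hpoinc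
  · exact sum_nonneg fun _ _ => sum_nonneg fun _ _ => sq_nonneg _
  · exact sum_nonneg fun _ _ => sum_nonneg fun _ _ => sq_nonneg _
  · exact sum_nonneg fun _ _ => sum_nonneg fun _ _ => sq_nonneg _
  · exact sum_nonneg fun _ _ => sum_nonneg fun _ _ => sq_nonneg _
  · exact sum_nonneg fun _ _ => sq_nonneg _

end TwoDimensional

section Gradient

open Finset

theorem cl_of_mem {N : ℕ} {i : ℤ} (h0 : 0 ≤ i) (hN : i < N) : cl N i = i := by
  unfold cl; omega

/-- The discrete gradient commutes with the Laplacian at interior edge points. -/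
theorem gradX_lapC {N : ℕ} {h : ℝ} (φ : ℤ → ℤ → ℝ) {i j : ℤ} (hi0 : 0 < i)
    (hi : i < N) (hj0 : 0 ≤ j) (hj : j < N) :
    gradX N h (lapC N h φ) i j
      = ((gradX N h φ (i + 1) j - 2 * gradX N h φ i j + gradX N h φ (i - 1) j)
        + (gradX N h φ i (j + 1) - 2 * gradX N h φ i j + gradX N h φ i (j - 1))) / h ^ 2 := by
  have h1 : ∀ f : ℤ → ℤ → ℝ, gradX N h f i j = (f i j - f (i - 1) j) / h := fun f => by
    simp only [gradX, extC, cl_of_mem hi0.le hi, cl_of_mem hj0 hj,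
      cl_of_mem (show 0 ≤ i - 1 by omega) (show i - 1 < N by omega)]
  rw [h1]
  simp only [lapC, gradX, add_sub_cancel_right, sub_add_cancel]
  ring

theorem sum_gradX_sq_le_gnormC2 (N : ℕ) (h : ℝ) (f : ℤ → ℤ → ℝ) :
    h ^ 2 * ∑ i ∈ range N, ∑ j ∈ range N, gradX N h f i j ^ 2 ≤ gnormC2 N h f := by
  simp only [gnormC2, normV2, ipV, ← sq]
  rw [sum_range_succ, mul_add, add_assoc]
  refine le_add_of_nonneg_right (add_nonneg ?_ ?_)
  · exact mul_nonneg (sq_nonneg h) (sum_nonneg fun _ _ => sq_nonneg _)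
  · exact mul_nonneg (sq_nonneg h) (sum_nonneg fun _ _ => sum_nonneg fun _ _ => sq_nonneg _)

theorem gradX_pow_four_le {N : ℕ} {h : ℝ} (hh : 0 < h) (φ : ℤ → ℤ → ℝ) {m k : ℕ} (hm : m ≤ N)
    (hk : k < N) :
    gradX N h φ m k ^ 4 ≤ 64 * (gnormC2 N h φ * gnormC2 N h (lapC N h φ)) := by
  have hag := pow_four_le_sum_mul_sum_lap (N := N) (u := gradX N h φ)
    (w := fun i j => h ^ 2 * gradX N h (lapC N h φ) i j)
    (fun j => by
      have : cl N (-1) = cl N 0 := by unfold cl; omega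
      simp [gradX, extC, this])
    (fun j => by
      have : cl N (N - 1) = cl N N := by unfold cl; omega
      simp [gradX, extC, this])
    (fun i => by
      have : cl N (-1) = cl N 0 := by unfold cl; omega
      simp [gradX, extC, this])
    (fun i => by
      have : cl N (N - 1) = cl N N := by unfold cl; omega
      simp [gradX, extC, this])
    (fun i j hi0 hi hj => by
      rw [gradX_lapC φ (by exact_mod_cast hi0) (by exact_mod_cast hi) (by positivity)
        (by exact_mod_cast hj)]
      field_simp)
    hm hk
  simp only [mul_pow, ← mul_sum] at hag
  refine hag.trans ?_
  have h1 := sum_gradX_sq_le_gnormC2 N h φ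
  have h2 := sum_gradX_sq_le_gnormC2 N h (lapC N h φ)
  have hnn : ∀ f : ℤ → ℤ → ℝ, 0 ≤ h ^ 2 * ∑ i ∈ range N, ∑ j ∈ range N, gradX N h f i j ^ 2 :=
    fun f => mul_nonneg (sq_nonneg h) (sum_nonneg fun _ _ => sum_nonneg fun _ _ => sq_nonneg _)
  have h3 := mul_le_mul h1 h2 (hnn _) ((hnn φ).trans h1)
  linarith

theorem gnormC2_nonneg (N : ℕ) (h : ℝ) (f : ℤ → ℤ → ℝ) : 0 ≤ gnormC2 N h f := by
  simp only [gnormC2, normV2, ipV, ← sq]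
  exact add_nonneg
    (mul_nonneg (sq_nonneg h) (sum_nonneg fun _ _ => sum_nonneg fun _ _ => sq_nonneg _))
    (mul_nonneg (sq_nonneg h) (sum_nonneg fun _ _ => sum_nonneg fun _ _ => sq_nonneg _))

theorem abs_gradX_le {N : ℕ} {h : ℝ} (hh : 0 < h) (φ : ℤ → ℤ → ℝ) {m k : ℕ} (hm : m ≤ N)
    (hk : k < N) :
    |gradX N h φ m k| ≤ 3 * √√(gnormC2 N h φ) * √√(gnormC2 N h (lapC N h φ)) := by
  have hroot : ∀ f : ℤ → ℤ → ℝ, √√(gnormC2 N h f) ^ 4 = gnormC2 N h f := fun f => by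
    rw [show (4 : ℕ) = 2 * 2 from rfl, pow_mul, Real.sq_sqrt (Real.sqrt_nonneg _),
      Real.sq_sqrt (gnormC2_nonneg N h f)]
  refine le_of_pow_le_pow_left₀ (n := 4) (by norm_num) (by positivity) ?_
  rw [mul_pow, mul_pow, hroot, hroot, Even.pow_abs (by decide)]
  have h1 := gradX_pow_four_le hh φ hm hk
  nlinarith [mul_nonneg (gnormC2_nonneg N h φ) (gnormC2_nonneg N h (lapC N h φ))]

theorem gnormC2_swap (N : ℕ) (h : ℝ) (f : ℤ → ℤ → ℝ) :
    gnormC2 N h (fun i j => f j i) = gnormC2 N h f := by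
  simp only [gnormC2, normV2, ipV]
  rw [add_comm]
  congr 2 <;> exact sum_comm

theorem lapC_swap (N : ℕ) (h : ℝ) (f : ℤ → ℤ → ℝ) :
    lapC N h (fun i j => f j i) = fun i j => lapC N h f j i := by
  funext i j
  simp only [lapC, extC]
  ring

end Gradient

end MAC

open Finset in
/-- **Discrete Sobolev interpolation inequality for the gradient**: there is
`C₁ > 0`, independent of the resolution, with
`‖∇_h φ‖_∞ ≤ C₁ ‖∇_h φ‖₂^{1/2} ‖∇_h Δ_h φ‖₂^{1/2}` for all zero-mean
cell-centered `φ` (the `∞`-norm bound is stated at every edge point, for both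
gradient components). -/
theorem discrete_sobolev_grad_Linf :
    ∃ C₁ : ℝ, 0 < C₁ ∧ ∀ N : ℕ, 2 ≤ N → ∀ φ : ℤ → ℤ → ℝ,
      MAC.meanC N (1 / N) φ = 0 →
      (∀ i ∈ range (N + 1), ∀ j ∈ range N,
          |MAC.gradX N (1 / N) φ i j|
            ≤ C₁ * Real.sqrt (Real.sqrt (MAC.gnormC2 N (1 / N) φ))
                * Real.sqrt (Real.sqrt (MAC.gnormC2 N (1 / N)
                    (MAC.lapC N (1 / N) φ)))) ∧
      (∀ i ∈ range N, ∀ j ∈ range (N + 1),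
          |MAC.gradY N (1 / N) φ i j|
            ≤ C₁ * Real.sqrt (Real.sqrt (MAC.gnormC2 N (1 / N) φ))
                * Real.sqrt (Real.sqrt (MAC.gnormC2 N (1 / N)
                    (MAC.lapC N (1 / N) φ)))) := by
  refine ⟨3, by norm_num, fun N hN φ _ => ?_⟩
  have hh : (0 : ℝ) < 1 / N := by positivity
  refine ⟨fun i hi j hj => ?_, fun i hi j hj => ?_⟩
  · exact MAC.abs_gradX_le hh φ (Nat.lt_succ_iff.1 (mem_range.1 hi)) (mem_range.1 hj)
  · have h1 := MAC.abs_gradX_le hh (fun a b => φ b a)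
      (Nat.lt_succ_iff.1 (mem_range.1 hj)) (mem_range.1 hi)
    rwa [MAC.lapC_swap, MAC.gnormC2_swap N _ φ, MAC.gnormC2_swap N _ (MAC.lapC N _ φ)] at h1
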